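/- arXiv:2202.13691 — 6 statements merged into one kernel-verified Lean document; each statement's English description precedes it below -/
import Mathlib

section
/- Under the stated setup (quadrature exactness degree n+k with 0 < k ≤ n), for every f ∈ C([−1,1]) and every polynomial χ of degree at most k, the discrete residual of degree-n hyperinterpolation is orthogonal to χ: ⟨f − L_n f, χ⟩_m = 0. -/
open MeasureTheory

/-- The discrete inner product `⟨v,z⟩_m = ∑_j w_j v(x_j) z(x_j)` of an m-point
quadrature rule with points `x` and weights `w`. -/
noncomputable def discInner {m : ℕ} (w x : Fin m → ℝ) (v z : ℝ → ℝ) : ℝ :=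
  ∑ j, w j * v (x j) * z (x j)

/-- The hyperinterpolant of degree `t`:  `L_t f = ∑_{ℓ=0}^{t} ⟨f, p_ℓ⟩_m p_ℓ`. -/
noncomputable def hyper {m : ℕ} (w x : Fin m → ℝ) (p : ℕ → Polynomial ℝ)
    (t : ℕ) (f : ℝ → ℝ) : Polynomial ℝ :=
  ∑ ℓ ∈ Finset.range (t + 1),
    Polynomial.C (discInner w x f (fun y => (p ℓ).eval y)) * p ℓ

/-- The "tail" operator `(L_n − L_k) f = ∑_{ℓ=k+1}^{n} ⟨f, p_ℓ⟩_m p_ℓ`. -/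
noncomputable def hyperDiff {m : ℕ} (w x : Fin m → ℝ) (p : ℕ → Polynomial ℝ)
    (k n : ℕ) (f : ℝ → ℝ) : Polynomial ℝ :=
  ∑ ℓ ∈ Finset.Ioc k n,
    Polynomial.C (discInner w x f (fun y => (p ℓ).eval y)) * p ℓ

/-- Polynomials `p 0, …, p t` with `natDegree (p ℓ) = ℓ` and `p ℓ ≠ 0` span the polynomials of
degree at most `t`. -/
theorem Polynomial.exists_eq_sum_C_mul_of_natDegree_le {K : Type*} [Field K]
    (p : ℕ → Polynomial K) (t : ℕ) (hdeg : ∀ ℓ ≤ t, (p ℓ).natDegree = ℓ)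
    (hne : ∀ ℓ ≤ t, p ℓ ≠ 0) (q : Polynomial K) (hq : q.natDegree ≤ t) :
    ∃ c : ℕ → K, q = ∑ ℓ ∈ Finset.range (t + 1), Polynomial.C (c ℓ) * p ℓ := by
  have hspan (ℓ : ℕ) (hℓ : ℓ ≤ t) (q : Polynomial K) (hq : q.natDegree ≤ ℓ) :
      q ∈ Submodule.span K (p '' (Finset.range (t + 1) : Set ℕ)) := by
    induction ℓ generalizing q with
    | zero =>
      have hp : p 0 ∈ Submodule.span K (p '' (Finset.range (t + 1) : Set ℕ)) :=
        Submodule.subset_span ⟨0, by simp, rfl⟩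
      obtain ⟨a, ha⟩ := Polynomial.natDegree_eq_zero.mp (hdeg 0 hℓ)
      obtain ⟨b, rfl⟩ := Polynomial.natDegree_eq_zero.mp (Nat.le_zero.mp hq)
      have ha0 : a ≠ 0 := by
        rintro rfl
        exact hne 0 hℓ (by simp [← ha])
      have hb : Polynomial.C b = (b / a) • p 0 := by
        rw [← ha, Polynomial.smul_C, smul_eq_mul, div_mul_cancel₀ _ ha0]
      rw [hb]
      exact Submodule.smul_mem _ _ hp
    | succ d ih =>
      have hp : p (d + 1) ∈ Submodule.span K (p '' (Finset.range (t + 1) : Set ℕ)) :=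
        Submodule.subset_span ⟨d + 1, by simpa using hℓ, rfl⟩
      have hlead : (p (d + 1)).coeff (d + 1) ≠ 0 := by
        have h := Polynomial.leadingCoeff_ne_zero.mpr (hne (d + 1) hℓ)
        rwa [Polynomial.leadingCoeff, hdeg _ hℓ] at h
      set c : K := q.coeff (d + 1) / (p (d + 1)).coeff (d + 1) with hc
      have hr : (q - c • p (d + 1)).natDegree ≤ d := by
        rw [Polynomial.natDegree_le_iff_coeff_eq_zero]
        intro N hN
        rcases (Nat.succ_le_of_lt hN).eq_or_lt with rfl | hN'
        · simp [hc, div_mul_cancel₀ _ hlead]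
        · have hN' : d + 1 < N := hN'
          rw [Polynomial.coeff_sub, Polynomial.coeff_smul,
            Polynomial.coeff_eq_zero_of_natDegree_lt (hq.trans_lt hN'),
            Polynomial.coeff_eq_zero_of_natDegree_lt ((hdeg _ hℓ).trans_lt hN')]
          simp
      rw [← sub_add_cancel q (c • p (d + 1))]
      exact Submodule.add_mem _ (ih (by omega) _ hr) (Submodule.smul_mem _ _ hp)
  obtain ⟨c, hc⟩ := (Submodule.mem_span_image_finset_iff_exists_fun' K).mp
    (hspan t le_rfl q hq)
  exact ⟨c, by simp [← hc, Polynomial.smul_eq_C_mul]⟩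

/-- Linearity of the discrete inner product in its second argument. -/
theorem discInner_eval_sum_right {m : ℕ} (w x : Fin m → ℝ) (v : ℝ → ℝ) (s : Finset ℕ)
    (c : ℕ → ℝ) (p : ℕ → Polynomial ℝ) :
    discInner w x v (fun y => (∑ ℓ ∈ s, Polynomial.C (c ℓ) * p ℓ).eval y) =
      ∑ ℓ ∈ s, c ℓ * discInner w x v (fun y => (p ℓ).eval y) := by
  simp only [discInner, Polynomial.eval_finsetSum, Polynomial.eval_mul, Polynomial.eval_C,
    Finset.mul_sum]
  rw [Finset.sum_comm]
  exact Finset.sum_congr rfl fun _ _ => Finset.sum_congr rfl fun _ _ => by ring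

theorem discInner_comm {m : ℕ} (w x : Fin m → ℝ) (v z : ℝ → ℝ) :
    discInner w x v z = discInner w x z v :=
  Finset.sum_congr rfl fun _ _ => by ring

theorem discInner_sub_left {m : ℕ} (w x : Fin m → ℝ) (u v z : ℝ → ℝ) :
    discInner w x (fun y => u y - v y) z = discInner w x u z - discInner w x v z := by
  simp only [discInner, ← Finset.sum_sub_distrib]
  exact Finset.sum_congr rfl fun _ _ => by ring

/-- `⟨f − L_n f, χ⟩_m = 0` for every polynomial `χ` of degree at most `k`. -/
theorem discrete_residual_orthogonal_n
    (n k m : ℕ) (hn : 1 ≤ n) (hk0 : 0 < k) (hkn : k ≤ n)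
    (x w : Fin m → ℝ)
    (hx : ∀ j, x j ∈ Set.Icc (-1 : ℝ) 1)
    (hw : ∀ j, 0 < w j)
    (hex : ∀ g : Polynomial ℝ, g.natDegree ≤ n + k →
      ∑ j, w j * g.eval (x j) = ∫ y in (-1 : ℝ)..1, g.eval y)
    (p : ℕ → Polynomial ℝ)
    (hdeg : ∀ ℓ, ℓ ≤ n → (p ℓ).natDegree = ℓ)
    (horth : ∀ ℓ ℓ', ℓ ≤ n → ℓ' ≤ n →
      (∫ y in (-1 : ℝ)..1, (p ℓ).eval y * (p ℓ').eval y) = if ℓ = ℓ' then 1 else 0)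
    (f : ℝ → ℝ) (hf : ContinuousOn f (Set.Icc (-1 : ℝ) 1))
    (χ : Polynomial ℝ) (hχ : χ.natDegree ≤ k) :
    discInner w x (fun y => f y - (hyper w x p n f).eval y) (fun y => χ.eval y) = 0 := by
  have hne (ℓ : ℕ) (hℓ : ℓ ≤ n) : p ℓ ≠ 0 := by
    intro h
    simpa [h] using horth ℓ ℓ hℓ hℓ
  have hdisc (i ℓ : ℕ) (hi : i ≤ k) (hℓ : ℓ ≤ n) :
      discInner w x (fun y => (p i).eval y) (fun y => (p ℓ).eval y) =
        if i = ℓ then 1 else 0 := by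
    have hdeg_mul : (p i * p ℓ).natDegree ≤ n + k := by
      have h := Polynomial.natDegree_mul_le (p := p i) (q := p ℓ)
      rw [hdeg i (hi.trans hkn), hdeg ℓ hℓ] at h
      omega
    rw [← horth i ℓ (hi.trans hkn) hℓ]
    simpa [discInner, mul_assoc] using hex _ hdeg_mul
  obtain ⟨c, rfl⟩ := Polynomial.exists_eq_sum_C_mul_of_natDegree_le p k
    (fun ℓ hℓ => hdeg ℓ (hℓ.trans hkn)) (fun ℓ hℓ => hne ℓ (hℓ.trans hkn)) χ hχ
  rw [discInner_eval_sum_right]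
  refine Finset.sum_eq_zero fun i hi => ?_
  have hik : i ≤ k := Nat.lt_succ_iff.mp (Finset.mem_range.mp hi)
  have hproj : discInner w x (fun y => (hyper w x p n f).eval y) (fun y => (p i).eval y) =
      discInner w x f (fun y => (p i).eval y) := by
    rw [discInner_comm, hyper, discInner_eval_sum_right, Finset.sum_eq_single i]
    · simp [hdisc i i hik (hik.trans hkn)]
    · intro ℓ hℓ hne
      simp [hdisc i ℓ hik (Nat.lt_succ_iff.mp (Finset.mem_range.mp hℓ)), hne.symm]
    · intro h
      exact absurd (Finset.mem_range.mpr (by omega)) h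
  rw [discInner_sub_left, hproj, sub_self, mul_zero]
end

section
/- Under the stated setup (quadrature exactness degree n+k with 0 < k ≤ n), for every f ∈ C([−1,1]) one has ⟨L_k f, L_k f⟩_m + ⟨L_n f − L_k f, L_n f − L_k f⟩_m = ⟨L_n f, L_n f⟩_m. -/
open MeasureTheory

/-- The tail operator is the difference of two hyperinterpolants. -/
lemma hyper_add_hyperDiff {m : ℕ} (w x : Fin m → ℝ) (p : ℕ → Polynomial ℝ)
    {k n : ℕ} (hkn : k ≤ n) (f : ℝ → ℝ) :
    hyper w x p k f + hyperDiff w x p k n f = hyper w x p n f := by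
  have hIoc : Finset.Ioc k n = Finset.Ico (k + 1) (n + 1) := by
    ext ℓ
    simp only [Finset.mem_Ioc, Finset.mem_Ico]
    omega
  rw [hyper, hyper, hyperDiff, hIoc]
  exact Finset.sum_range_add_sum_Ico _ (by omega)

/-- Polynomials of low enough total degree have the same `L²` and
discrete inner product. -/
lemma discInner_eval_eq_integral {m d : ℕ} {w x : Fin m → ℝ}
    (hex : ∀ g : Polynomial ℝ, g.natDegree ≤ d →
      ∑ j, w j * g.eval (x j) = ∫ y in (-1 : ℝ)..1, g.eval y)
    {q r : Polynomial ℝ} (hqr : q.natDegree + r.natDegree ≤ d) :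
    discInner w x (fun y => q.eval y) (fun y => r.eval y) =
      ∫ y in (-1 : ℝ)..1, q.eval y * r.eval y := by
  simpa [discInner, mul_assoc] using hex (q * r) (Polynomial.natDegree_mul_le.trans hqr)

/-- Bilinearity of the discrete inner product, for linear combinations of polynomials. -/
lemma discInner_eval_sum {m : ℕ} (w x : Fin m → ℝ) (p : ℕ → Polynomial ℝ) (a b : ℕ → ℝ)
    (s t : Finset ℕ) :
    discInner w x (fun y => (∑ i ∈ s, Polynomial.C (a i) * p i).eval y)
        (fun y => (∑ i ∈ t, Polynomial.C (b i) * p i).eval y) =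
      ∑ i ∈ s, ∑ j ∈ t,
        a i * b j * discInner w x (fun y => (p i).eval y) (fun y => (p j).eval y) := by
  simp only [discInner, Polynomial.eval_finsetSum, Polynomial.eval_mul, Polynomial.eval_C]
  simp_rw [mul_assoc, Finset.sum_mul_sum, Finset.mul_sum]
  rw [Finset.sum_comm]
  refine Finset.sum_congr rfl fun i _ => ?_
  rw [Finset.sum_comm]
  exact Finset.sum_congr rfl fun j _ => Finset.sum_congr rfl fun l _ => by ring

/-- `⟨L_k f, L_k f⟩_m + ⟨L_n f − L_k f, L_n f − L_k f⟩_m = ⟨L_n f, L_n f⟩_m`. -/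
theorem discrete_pythagoras_nk
    (n k m : ℕ) (hn : 1 ≤ n) (hk0 : 0 < k) (hkn : k ≤ n)
    (x w : Fin m → ℝ)
    (hx : ∀ j, x j ∈ Set.Icc (-1 : ℝ) 1)
    (hw : ∀ j, 0 < w j)
    (hex : ∀ g : Polynomial ℝ, g.natDegree ≤ n + k →
      ∑ j, w j * g.eval (x j) = ∫ y in (-1 : ℝ)..1, g.eval y)
    (p : ℕ → Polynomial ℝ)
    (hdeg : ∀ ℓ, ℓ ≤ n → (p ℓ).natDegree = ℓ)
    (horth : ∀ ℓ ℓ', ℓ ≤ n → ℓ' ≤ n →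
      (∫ y in (-1 : ℝ)..1, (p ℓ).eval y * (p ℓ').eval y) = if ℓ = ℓ' then 1 else 0)
    (f : ℝ → ℝ) (hf : ContinuousOn f (Set.Icc (-1 : ℝ) 1))
    :
    discInner w x (fun y => (hyper w x p k f).eval y) (fun y => (hyper w x p k f).eval y) +
        discInner w x (fun y => (hyper w x p n f).eval y - (hyper w x p k f).eval y)
          (fun y => (hyper w x p n f).eval y - (hyper w x p k f).eval y) =
      discInner w x (fun y => (hyper w x p n f).eval y) (fun y => (hyper w x p n f).eval y) := by
  have hcross : discInner w x (fun y => (hyper w x p k f).eval y)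
      (fun y => (hyperDiff w x p k n f).eval y) = 0 := by
    rw [hyper, hyperDiff, discInner_eval_sum]
    refine Finset.sum_eq_zero fun i hi => Finset.sum_eq_zero fun j hj => ?_
    rw [Finset.mem_range] at hi
    rw [Finset.mem_Ioc] at hj
    have hin : i ≤ n := by omega
    rw [discInner_eval_eq_integral hex (by rw [hdeg i hin, hdeg j hj.2]; omega),
      horth i j hin hj.2, if_neg (by omega), mul_zero]
  rw [← hyper_add_hyperDiff w x p hkn f]
  simp only [discInner, Polynomial.eval_add, add_sub_cancel_left] at hcross ⊢
  rw [← sub_eq_zero, ← Finset.sum_add_distrib, ← Finset.sum_sub_distrib]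
  refine Eq.trans ?_ (mul_eq_zero_of_right (-2) hcross)
  rw [Finset.mul_sum]
  exact Finset.sum_congr rfl fun j _ => by ring
end

section
/- Under the stated setup (quadrature exactness degree n+k with 0 < k ≤ n), for every f ∈ C([−1,1]) one has ⟨f − L_n f, f − L_n f⟩_m + 2⟨f, L_n f − L_k f⟩_m = ⟨f − L_k f, f − L_k f⟩_m + ⟨L_n f − L_k f, L_n f − L_k f⟩_m. -/
open MeasureTheory

/-- For `k ≤ n`, the difference `L_n f - L_k f` is the tail of the expansion. -/
theorem hyper_sub_hyper {m : ℕ} (w x : Fin m → ℝ) (p : ℕ → Polynomial ℝ) {k n : ℕ}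
    (hkn : k ≤ n) (f : ℝ → ℝ) :
    hyper w x p n f - hyper w x p k f = hyperDiff w x p k n f := by
  have hIoc : Finset.Ioc k n = Finset.Ico (k + 1) (n + 1) := by
    ext i
    simp only [Finset.mem_Ioc, Finset.mem_Ico]
    omega
  rw [hyper, hyper, hyperDiff, hIoc, Finset.sum_Ico_eq_sub _ (by omega)]

/-- The discrete inner product of two polynomial sums, expanded bilinearly. -/
theorem discInner_sum_sum {m : ℕ} (w x : Fin m → ℝ) (p : ℕ → Polynomial ℝ) (s t : Finset ℕ)
    (a b : ℕ → ℝ) :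
    discInner w x (fun y => (∑ i ∈ s, Polynomial.C (a i) * p i).eval y)
        (fun y => (∑ j ∈ t, Polynomial.C (b j) * p j).eval y) =
      ∑ i ∈ s, ∑ j ∈ t,
        a i * b j * discInner w x (fun y => (p i).eval y) (fun y => (p j).eval y) := by
  simp only [discInner, Polynomial.eval_finsetSum, Polynomial.eval_mul, Polynomial.eval_C,
    Finset.mul_sum, Finset.sum_mul]
  rw [Finset.sum_congr rfl fun _ _ => Finset.sum_comm, Finset.sum_comm]
  refine Finset.sum_congr rfl fun i _ => ?_
  rw [Finset.sum_comm]
  exact Finset.sum_congr rfl fun j _ => Finset.sum_congr rfl fun l _ => by ring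

/-- If the rule is exact to degree `n + k`, then `L_k f` is discretely orthogonal to the tail
`(L_n - L_k) f`. -/
theorem discInner_hyper_hyperDiff {n k m : ℕ} (hkn : k ≤ n) {x w : Fin m → ℝ}
    (hex : ∀ g : Polynomial ℝ, g.natDegree ≤ n + k →
      ∑ j, w j * g.eval (x j) = ∫ y in (-1 : ℝ)..1, g.eval y)
    {p : ℕ → Polynomial ℝ} (hdeg : ∀ ℓ, ℓ ≤ n → (p ℓ).natDegree = ℓ)
    (horth : ∀ ℓ ℓ', ℓ ≤ n → ℓ' ≤ n →
      (∫ y in (-1 : ℝ)..1, (p ℓ).eval y * (p ℓ').eval y) = if ℓ = ℓ' then 1 else 0)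
    (f : ℝ → ℝ) :
    discInner w x (fun y => (hyper w x p k f).eval y)
      (fun y => (hyperDiff w x p k n f).eval y) = 0 := by
  unfold hyper hyperDiff
  rw [discInner_sum_sum]
  refine Finset.sum_eq_zero fun i hi => Finset.sum_eq_zero fun j hj => ?_
  rw [Finset.mem_range] at hi
  rw [Finset.mem_Ioc] at hj
  have hdeg_mul : (p i * p j).natDegree ≤ n + k := by
    have hmul := Polynomial.natDegree_mul_le (p := p i) (q := p j)
    rw [hdeg i (by omega), hdeg j hj.2] at hmul
    omega
  have hexact := hex _ hdeg_mul
  simp only [Polynomial.eval_mul, ← mul_assoc] at hexact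
  rw [horth i j (by omega) hj.2, if_neg (by omega)] at hexact
  exact mul_eq_zero_of_right _ hexact

/-- `⟨f − L_n f, f − L_n f⟩_m + 2⟨f, L_n f − L_k f⟩_m = ⟨f − L_k f, f − L_k f⟩_m + ⟨L_n f − L_k f, L_n f − L_k f⟩_m`. -/
theorem discrete_identity_d
    (n k m : ℕ) (hn : 1 ≤ n) (hk0 : 0 < k) (hkn : k ≤ n)
    (x w : Fin m → ℝ)
    (hx : ∀ j, x j ∈ Set.Icc (-1 : ℝ) 1)
    (hw : ∀ j, 0 < w j)
    (hex : ∀ g : Polynomial ℝ, g.natDegree ≤ n + k →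
      ∑ j, w j * g.eval (x j) = ∫ y in (-1 : ℝ)..1, g.eval y)
    (p : ℕ → Polynomial ℝ)
    (hdeg : ∀ ℓ, ℓ ≤ n → (p ℓ).natDegree = ℓ)
    (horth : ∀ ℓ ℓ', ℓ ≤ n → ℓ' ≤ n →
      (∫ y in (-1 : ℝ)..1, (p ℓ).eval y * (p ℓ').eval y) = if ℓ = ℓ' then 1 else 0)
    (f : ℝ → ℝ) (hf : ContinuousOn f (Set.Icc (-1 : ℝ) 1))
    :
    discInner w x (fun y => f y - (hyper w x p n f).eval y) (fun y => f y - (hyper w x p n f).eval y) +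
        2 * discInner w x f (fun y => (hyper w x p n f).eval y - (hyper w x p k f).eval y) =
      discInner w x (fun y => f y - (hyper w x p k f).eval y) (fun y => f y - (hyper w x p k f).eval y) +
        discInner w x (fun y => (hyper w x p n f).eval y - (hyper w x p k f).eval y)
          (fun y => (hyper w x p n f).eval y - (hyper w x p k f).eval y) := by
  have horthogonal := discInner_hyper_hyperDiff hkn hex hdeg horth f
  simp only [← hyper_sub_hyper w x p hkn f, Polynomial.eval_sub] at horthogonal
  refine sub_eq_zero.mp (Eq.trans ?_ (mul_eq_zero_of_right 2 horthogonal))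
  simp only [discInner, Finset.mul_sum, ← Finset.sum_add_distrib, ← Finset.sum_sub_distrib]
  exact Finset.sum_congr rfl fun j _ => by ring
end

section
/- Under the stated setup (quadrature exactness degree n+k with 0 < k ≤ n), for every f ∈ C([−1,1]) the squared L² norm of the degree-n hyperinterpolant decomposes as ∫_{−1}^{1} (L_n f)(x)² dx = ⟨L_k f, L_k f⟩_m + ⟨f, (L_n − L_k)f⟩_m, where (L_n − L_k)f = ∑_{ℓ=k+1}^{n} ⟨f, p_ℓ⟩_m p_ℓ. -/
open MeasureTheory

/-- Parseval's identity for a linear combination of orthonormal polynomials on `[-1, 1]`. -/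
theorem integral_sq_eval_sum_C_mul (s : Finset ℕ) (c : ℕ → ℝ) (p : ℕ → Polynomial ℝ)
    (horth : ∀ i ∈ s, ∀ j ∈ s,
      (∫ y in (-1 : ℝ)..1, (p i).eval y * (p j).eval y) = if i = j then 1 else 0) :
    (∫ y in (-1 : ℝ)..1, ((∑ i ∈ s, Polynomial.C (c i) * p i).eval y) ^ 2) =
      ∑ i ∈ s, c i ^ 2 := by
  have hexpand : ∀ y : ℝ, ((∑ i ∈ s, Polynomial.C (c i) * p i).eval y) ^ 2 =
      ∑ i ∈ s, ∑ j ∈ s, c i * c j * ((p i).eval y * (p j).eval y) := by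
    intro y
    simp only [Polynomial.eval_finsetSum, Polynomial.eval_mul, Polynomial.eval_C, sq,
      Finset.sum_mul_sum]
    exact Finset.sum_congr rfl fun i _ => Finset.sum_congr rfl fun j _ => by ring
  have hint : ∀ i j, IntervalIntegrable
      (fun y : ℝ => c i * c j * ((p i).eval y * (p j).eval y)) volume (-1) 1 := fun i j =>
    (continuous_const.mul ((p i).continuous.mul (p j).continuous)).intervalIntegrable _ _
  simp only [hexpand]
  rw [intervalIntegral.integral_finsetSum fun i _ => by
    simpa only [Finset.sum_fn] using IntervalIntegrable.sum s fun j _ => hint i j]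
  refine Finset.sum_congr rfl fun i hi => ?_
  rw [intervalIntegral.integral_finsetSum fun j _ => hint i j]
  calc ∑ j ∈ s, ∫ y in (-1 : ℝ)..1, c i * c j * ((p i).eval y * (p j).eval y)
      = ∑ j ∈ s, if i = j then c i * c j else 0 :=
        Finset.sum_congr rfl fun j hj => by
          rw [intervalIntegral.integral_const_mul, horth i hi j hj, mul_ite, mul_one, mul_zero]
    _ = c i ^ 2 := by rw [Finset.sum_ite_eq, if_pos hi, sq]

/-- Pairing `f` with its tail gives the sum of the squared discrete coefficients. -/
theorem discInner_hyperDiff {m : ℕ} (w x : Fin m → ℝ) (p : ℕ → Polynomial ℝ) (k n : ℕ)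
    (f : ℝ → ℝ) :
    discInner w x f (fun y => (hyperDiff w x p k n f).eval y) =
      ∑ ℓ ∈ Finset.Ioc k n, discInner w x f (fun y => (p ℓ).eval y) ^ 2 := by
  have hlin : ∀ c : ℕ → ℝ,
      discInner w x f (fun y => (∑ ℓ ∈ Finset.Ioc k n, Polynomial.C (c ℓ) * p ℓ).eval y) =
        ∑ ℓ ∈ Finset.Ioc k n, c ℓ * discInner w x f (fun y => (p ℓ).eval y) := by
    intro c
    simp only [discInner, Polynomial.eval_finsetSum, Polynomial.eval_mul, Polynomial.eval_C,
      Finset.mul_sum]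
    rw [Finset.sum_comm]
    exact Finset.sum_congr rfl fun i _ => Finset.sum_congr rfl fun j _ => by ring
  simp only [sq]
  exact hlin _

/-- The hyperinterpolant of degree `t` has degree at most `t`. -/
theorem natDegree_hyper_le {m : ℕ} (w x : Fin m → ℝ) (p : ℕ → Polynomial ℝ) (t : ℕ)
    (f : ℝ → ℝ) (hdeg : ∀ ℓ ≤ t, (p ℓ).natDegree ≤ ℓ) :
    (hyper w x p t f).natDegree ≤ t := by
  refine Polynomial.natDegree_sum_le_of_forall_le _ _ fun ℓ hℓ => ?_
  have hle : ℓ ≤ t := Nat.lt_succ_iff.mp (Finset.mem_range.mp hℓ)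
  exact (Polynomial.natDegree_C_mul_le _ _).trans ((hdeg ℓ hle).trans hle)

/-- `∫_{−1}^{1} (L_n f)(x)² dx = ⟨L_k f, L_k f⟩_m + ⟨f, (L_n−L_k)f⟩_m`. -/
theorem norm_decomposition
    (n k m : ℕ) (hn : 1 ≤ n) (hk0 : 0 < k) (hkn : k ≤ n)
    (x w : Fin m → ℝ)
    (hx : ∀ j, x j ∈ Set.Icc (-1 : ℝ) 1)
    (hw : ∀ j, 0 < w j)
    (hex : ∀ g : Polynomial ℝ, g.natDegree ≤ n + k →
      ∑ j, w j * g.eval (x j) = ∫ y in (-1 : ℝ)..1, g.eval y)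
    (p : ℕ → Polynomial ℝ)
    (hdeg : ∀ ℓ, ℓ ≤ n → (p ℓ).natDegree = ℓ)
    (horth : ∀ ℓ ℓ', ℓ ≤ n → ℓ' ≤ n →
      (∫ y in (-1 : ℝ)..1, (p ℓ).eval y * (p ℓ').eval y) = if ℓ = ℓ' then 1 else 0)
    (f : ℝ → ℝ) (hf : ContinuousOn f (Set.Icc (-1 : ℝ) 1))
    :
    (∫ y in (-1 : ℝ)..1, ((hyper w x p n f).eval y) ^ 2) =
      discInner w x (fun y => (hyper w x p k f).eval y) (fun y => (hyper w x p k f).eval y) +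
        discInner w x f (fun y => (hyperDiff w x p k n f).eval y) := by
  have hsq : ∀ t ≤ n, (∫ y in (-1 : ℝ)..1, ((hyper w x p t f).eval y) ^ 2) =
      ∑ ℓ ∈ Finset.range (t + 1), discInner w x f (fun y => (p ℓ).eval y) ^ 2 := by
    intro t ht
    refine integral_sq_eval_sum_C_mul _ _ _ fun i hi j hj => horth i j ?_ ?_
    · exact (Nat.lt_succ_iff.mp (Finset.mem_range.mp hi)).trans ht
    · exact (Nat.lt_succ_iff.mp (Finset.mem_range.mp hj)).trans ht
  have hdisc : discInner w x (fun y => (hyper w x p k f).eval y)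
      (fun y => (hyper w x p k f).eval y) =
        ∫ y in (-1 : ℝ)..1, ((hyper w x p k f).eval y) ^ 2 := by
    have hdegk : (hyper w x p k f).natDegree ≤ k :=
      natDegree_hyper_le w x p k f fun ℓ hℓ => (hdeg ℓ (hℓ.trans hkn)).le
    have hdegsq : (hyper w x p k f ^ 2).natDegree ≤ n + k :=
      Polynomial.natDegree_pow_le.trans (by omega)
    simpa only [discInner, Polynomial.eval_mul, sq, mul_assoc] using hex _ hdegsq
  rw [hdisc, hsq n le_rfl, hsq k hkn, discInner_hyperDiff]
  rw [← Finset.sum_range_add_sum_Ico _ (Nat.succ_le_succ hkn)]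
  congr 2
  ext ℓ
  simp only [Finset.mem_Ico, Finset.mem_Ioc]
  omega
end

section
/- Stability of hyperinterpolation with relaxed exactness: under the stated setup (quadrature exactness degree n+k with 0 < k ≤ n) and assuming the Marcinkiewicz–Zygmund property with constant η ∈ (0,1), for every f ∈ C([−1,1]) the L² norm of the hyperinterpolant satisfies ‖L_n f‖₂ = (∫_{−1}^{1} (L_n f)(x)² dx)^{1/2} ≤ (2^{1/2}/√(1−η)) · sup_{x∈[−1,1]} |f(x)|. -/
open MeasureTheory

/-- If `p₀, …, p_t` are orthonormal in `L²(-1,1)`, then `‖L_t f‖₂² = ⟨f, L_t f⟩_m`. -/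
theorem integral_hyper_sq_eq_discInner {m : ℕ} (w x : Fin m → ℝ) (p : ℕ → Polynomial ℝ) (t : ℕ)
    (horth : ∀ ℓ ℓ', ℓ ≤ t → ℓ' ≤ t →
      (∫ y in (-1 : ℝ)..1, (p ℓ).eval y * (p ℓ').eval y) = if ℓ = ℓ' then 1 else 0)
    (f : ℝ → ℝ) :
    ∫ y in (-1 : ℝ)..1, ((hyper w x p t f).eval y) ^ 2 =
      discInner w x f (fun y => (hyper w x p t f).eval y) := by
  set c : ℕ → ℝ := fun ℓ => discInner w x f (fun y => (p ℓ).eval y) with hc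
  have heval : ∀ y, (hyper w x p t f).eval y =
      ∑ ℓ ∈ Finset.range (t + 1), c ℓ * (p ℓ).eval y := fun y => by
    simp [hyper, Polynomial.eval_finsetSum, hc]
  have hdisc : discInner w x f (fun y => (hyper w x p t f).eval y) =
      ∑ ℓ ∈ Finset.range (t + 1), c ℓ * c ℓ := by
    simp only [discInner, heval, Finset.mul_sum]
    rw [Finset.sum_comm]
    refine Finset.sum_congr rfl fun ℓ _ => ?_
    change _ = c ℓ * ∑ j, w j * f (x j) * (p ℓ).eval (x j)
    rw [Finset.mul_sum]
    exact Finset.sum_congr rfl fun j _ => by ring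
  rw [hdisc]
  simp only [heval, sq, Finset.sum_mul_sum]
  rw [intervalIntegral.integral_finsetSum
    fun i _ => Continuous.intervalIntegrable (by fun_prop) _ _]
  refine Finset.sum_congr rfl fun ℓ hℓ => ?_
  rw [intervalIntegral.integral_finsetSum
    fun i _ => Continuous.intervalIntegrable (by fun_prop) _ _]
  have hterm : ∀ ℓ' ∈ Finset.range (t + 1),
      (∫ y in (-1 : ℝ)..1, c ℓ * (p ℓ).eval y * (c ℓ' * (p ℓ').eval y)) =
        if ℓ = ℓ' then c ℓ * c ℓ' else 0 := fun ℓ' hℓ' => by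
    simp only [mul_mul_mul_comm (c ℓ) _ (c ℓ')]
    rw [intervalIntegral.integral_const_mul,
      horth ℓ ℓ' (Finset.mem_range_succ_iff.mp hℓ) (Finset.mem_range_succ_iff.mp hℓ'), mul_ite,
      mul_one, mul_zero]
  rw [Finset.sum_congr rfl hterm, Finset.sum_ite_eq, if_pos hℓ]

/-- Cauchy–Schwarz inequality for the discrete inner product. -/
theorem discInner_sq_le {m : ℕ} {w : Fin m → ℝ} (hw : ∀ j, 0 ≤ w j) (x : Fin m → ℝ)
    (v z : ℝ → ℝ) :
    discInner w x v z ^ 2 ≤ (∑ j, w j * v (x j) ^ 2) * ∑ j, w j * z (x j) ^ 2 :=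
  Finset.sum_sq_le_sum_mul_sum_of_sq_le_mul _
    (fun j _ => mul_nonneg (hw j) (sq_nonneg _)) (fun j _ => mul_nonneg (hw j) (sq_nonneg _))
    fun j _ => le_of_eq (by ring)

/-- stability `‖L_n f‖₂ ≤ (√2 / √(1−η)) ‖f‖_∞`. -/
theorem hyper_stability
    (n k m : ℕ) (hn : 1 ≤ n) (hk0 : 0 < k) (hkn : k ≤ n)
    (x w : Fin m → ℝ)
    (hx : ∀ j, x j ∈ Set.Icc (-1 : ℝ) 1)
    (hw : ∀ j, 0 < w j)
    (hex : ∀ g : Polynomial ℝ, g.natDegree ≤ n + k →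
      ∑ j, w j * g.eval (x j) = ∫ y in (-1 : ℝ)..1, g.eval y)
    (p : ℕ → Polynomial ℝ)
    (hdeg : ∀ ℓ, ℓ ≤ n → (p ℓ).natDegree = ℓ)
    (horth : ∀ ℓ ℓ', ℓ ≤ n → ℓ' ≤ n →
      (∫ y in (-1 : ℝ)..1, (p ℓ).eval y * (p ℓ').eval y) = if ℓ = ℓ' then 1 else 0)
    (η : ℝ) (hη : η ∈ Set.Ioo (0 : ℝ) 1)
    (hMZ : ∀ χ : Polynomial ℝ, χ.natDegree ≤ n →
      |(∑ j, w j * (χ.eval (x j)) ^ 2) - ∫ y in (-1 : ℝ)..1, (χ.eval y) ^ 2| ≤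
        η * ∫ y in (-1 : ℝ)..1, (χ.eval y) ^ 2)
    (f : ℝ → ℝ) (hf : ContinuousOn f (Set.Icc (-1 : ℝ) 1))
    :
    Real.sqrt (∫ y in (-1 : ℝ)..1, ((hyper w x p n f).eval y) ^ 2) ≤
      (Real.sqrt 2 / Real.sqrt (1 - η)) * ⨆ t : Set.Icc (-1 : ℝ) 1, |f t| := by
  obtain ⟨hη0, hη1⟩ := hη
  set M : ℝ := ⨆ t : Set.Icc (-1 : ℝ) 1, |f t|
  set L := hyper w x p n f with hL
  set I : ℝ := ∫ y in (-1 : ℝ)..1, (L.eval y) ^ 2 with hI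
  have hfM : ∀ j, |f (x j)| ≤ M := fun j => by
    have hbdd : BddAbove (Set.range fun t : Set.Icc (-1 : ℝ) 1 => |f t|) := by
      rw [← Set.image_eq_range (fun t => |f t|)]
      exact isCompact_Icc.bddAbove_image hf.abs
    exact le_ciSup hbdd ⟨x j, hx j⟩
  have hM0 : 0 ≤ M := Real.iSup_nonneg fun _ => abs_nonneg _
  have hI0 : 0 ≤ I :=
    intervalIntegral.integral_nonneg (by norm_num) fun _ _ => sq_nonneg _
  have hweights : ∑ j, w j = 2 := by
    have h := hex 1 (by simp)
    norm_num at h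
    exact h
  have hfsq : ∑ j, w j * f (x j) ^ 2 ≤ 2 * M ^ 2 := by
    rw [← hweights, Finset.sum_mul]
    exact Finset.sum_le_sum fun j _ => mul_le_mul_of_nonneg_left
      (sq_le_sq.mpr ((hfM j).trans (le_abs_self M))) (hw j).le
  have hLdeg : L.natDegree ≤ n :=
    Polynomial.natDegree_sum_le_of_forall_le _ _ fun ℓ hℓ =>
      have hℓn := Finset.mem_range_succ_iff.mp hℓ
      (Polynomial.natDegree_C_mul_le _ _).trans ((hdeg ℓ hℓn).le.trans hℓn)
  have hLsq : ∑ j, w j * L.eval (x j) ^ 2 ≤ (1 + η) * I := by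
    linarith [(abs_le.mp (hMZ L hLdeg)).2]
  have hIsq : I ^ 2 ≤ 2 * M ^ 2 * ((1 + η) * I) :=
    calc I ^ 2 = discInner w x f (fun y => L.eval y) ^ 2 := by
          rw [hI, hL, integral_hyper_sq_eq_discInner w x p n horth f]
      _ ≤ _ := discInner_sq_le (fun j => (hw j).le) x f _
      _ ≤ _ := mul_le_mul hfsq hLsq
          (Finset.sum_nonneg fun j _ => mul_nonneg (hw j).le (sq_nonneg _)) (by positivity)
  have hIle : I ≤ 2 * M ^ 2 * (1 + η) := by
    rcases hI0.eq_or_lt with h | h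
    · rw [← h]
      positivity
    · exact le_of_mul_le_mul_right (by linarith) h
  have hη1' : 0 < 1 - η := sub_pos.mpr hη1
  rw [← Real.sqrt_div zero_le_two]
  refine Real.sqrt_le_iff.mpr ⟨by positivity, ?_⟩
  rw [mul_pow, Real.sq_sqrt (by positivity), div_mul_eq_mul_div, le_div_iff₀ hη1']
  nlinarith [mul_le_mul_of_nonneg_right hIle hη1'.le, mul_nonneg (sq_nonneg M) (sq_nonneg η)]
end

section
/- Clenshaw–Curtis-type quadrature instance: let n ≥ 1 and let an m-point quadrature rule on [−1,1] with positive weights have exactness degree m−1 (as an m-point Clenshaw–Curtis rule does), where n+2 ≤ m ≤ 2n+1, so that k := m−1−n satisfies 0 < k ≤ n. If the rule additionally has the Marcinkiewicz–Zygmund property with constant η = 3/4, then for every f ∈ C([−1,1]) the hyperinterpolant of degree n satisfies ‖L_n f − f‖₂ ≤ 3 · 2^{1/2} · E_{m−1−n}(f), where E_t(f) = inf_{χ ∈ ℙ_t} sup_{x∈[−1,1]} |f(x) − χ(x)|. -/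
open MeasureTheory

open Polynomial in
/-- Polynomials `p 0, …, p n` with `p ℓ` of exact degree `ℓ` span the polynomials of degree at
most `n`. -/
theorem exists_eq_sum_of_natDegree_le (p : ℕ → ℝ[X]) (n : ℕ)
    (hdeg : ∀ ℓ, ℓ ≤ n → (p ℓ).natDegree = ℓ) (hne : ∀ ℓ, ℓ ≤ n → p ℓ ≠ 0)
    (q : ℝ[X]) (hq : q.natDegree ≤ n) :
    ∃ c : ℕ → ℝ, q = ∑ ℓ ∈ Finset.range (n + 1), C (c ℓ) * p ℓ := by
  induction n generalizing q with
  | zero =>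
    obtain ⟨b, hb⟩ := natDegree_eq_zero.1 (hdeg 0 le_rfl)
    obtain ⟨a, ha⟩ := natDegree_eq_zero.1 (Nat.le_zero.1 hq)
    have hb0 : b ≠ 0 := by
      rintro rfl
      exact hne 0 le_rfl (by rw [← hb, C_0])
    refine ⟨fun _ => a / b, ?_⟩
    simp only [zero_add, Finset.sum_range_one]
    rw [← ha, ← hb, ← C_mul, div_mul_cancel₀ _ hb0]
  | succ n ih =>
    have hlc : (p (n + 1)).coeff (n + 1) ≠ 0 := by
      have h := leadingCoeff_ne_zero.2 (hne (n + 1) le_rfl)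
      rwa [leadingCoeff, hdeg (n + 1) le_rfl] at h
    set a : ℝ := q.coeff (n + 1) / (p (n + 1)).coeff (n + 1) with ha
    have hr : (q - C a * p (n + 1)).natDegree ≤ n := by
      rw [natDegree_le_iff_coeff_eq_zero]
      intro k hk
      rcases eq_or_lt_of_le (Nat.succ_le_of_lt hk) with rfl | hk'
      · simp [ha, div_mul_cancel₀ _ hlc]
      · have h₁ := coeff_eq_zero_of_natDegree_lt (lt_of_le_of_lt hq hk')
        have h₂ : (p (n + 1)).coeff k = 0 :=
          coeff_eq_zero_of_natDegree_lt (by rw [hdeg (n + 1) le_rfl]; exact hk')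
        simp [h₁, h₂]
    obtain ⟨c, hc⟩ := ih (fun ℓ h => hdeg ℓ (by lia)) (fun ℓ h => hne ℓ (by lia)) _ hr
    refine ⟨Function.update c (n + 1) a, ?_⟩
    rw [Finset.sum_range_succ, Function.update_self, ← sub_eq_iff_eq_add, hc]
    refine Finset.sum_congr rfl fun ℓ hℓ => ?_
    rw [Function.update_of_ne (by have := Finset.mem_range.1 hℓ; lia)]

/-- The coefficients of a combination of orthonormal polynomials are its inner products with
them. -/
theorem integral_sum_mul_of_orthonormal (p : ℕ → Polynomial ℝ) (n : ℕ)
    (horth : ∀ ℓ ℓ', ℓ ≤ n → ℓ' ≤ n →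
      (∫ y in (-1 : ℝ)..1, (p ℓ).eval y * (p ℓ').eval y) = if ℓ = ℓ' then 1 else 0)
    (c : ℕ → ℝ) (k : ℕ) (hk : k ≤ n) :
    (∫ y in (-1 : ℝ)..1,
      (∑ ℓ ∈ Finset.range (n + 1), Polynomial.C (c ℓ) * p ℓ).eval y * (p k).eval y) = c k := by
  simp only [Polynomial.eval_finsetSum, Polynomial.eval_mul, Polynomial.eval_C, Finset.sum_mul,
    mul_assoc]
  rw [intervalIntegral.integral_finsetSum
    fun ℓ _ => Continuous.intervalIntegrable (by fun_prop) _ _]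
  simp only [intervalIntegral.integral_const_mul]
  rw [Finset.sum_eq_single_of_mem k (Finset.mem_range.2 (by lia))]
  · simp [horth k k hk hk]
  · intro ℓ hℓ hne
    rw [horth ℓ k (by have := Finset.mem_range.1 hℓ; lia) hk, if_neg hne, mul_zero]

/-- Hyperinterpolation reproduces polynomials of degree `k ≤ n` when the rule is exact to degree
`n + k`. -/
theorem hyper_polynomial_eq {m : ℕ} (w x : Fin m → ℝ) (p : ℕ → Polynomial ℝ) (n d : ℕ)
    (hex : ∀ g : Polynomial ℝ, g.natDegree ≤ d →
      ∑ j, w j * g.eval (x j) = ∫ y in (-1 : ℝ)..1, g.eval y)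
    (hdeg : ∀ ℓ, ℓ ≤ n → (p ℓ).natDegree = ℓ)
    (horth : ∀ ℓ ℓ', ℓ ≤ n → ℓ' ≤ n →
      (∫ y in (-1 : ℝ)..1, (p ℓ).eval y * (p ℓ').eval y) = if ℓ = ℓ' then 1 else 0)
    (q : Polynomial ℝ) (hqn : q.natDegree ≤ n) (hqd : q.natDegree + n ≤ d) :
    hyper w x p n (fun y => q.eval y) = q := by
  have hne : ∀ ℓ, ℓ ≤ n → p ℓ ≠ 0 := by
    intro ℓ hℓ h0
    have h := horth ℓ ℓ hℓ hℓ
    simp [h0] at h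
  obtain ⟨c, hc⟩ := exists_eq_sum_of_natDegree_le p n hdeg hne q hqn
  conv_rhs => rw [hc]
  refine Finset.sum_congr rfl fun k hk => ?_
  have hk' : k ≤ n := by have := Finset.mem_range.1 hk; lia
  have hcoef : discInner w x (fun y => q.eval y) (fun y => (p k).eval y) = c k := by
    have h := hex (q * p k) (Polynomial.natDegree_mul_le.trans (by rw [hdeg k hk']; lia))
    have hint := integral_sum_mul_of_orthonormal p n horth c k hk'
    rw [← hc] at hint
    simp only [Polynomial.eval_mul, hint] at h
    rw [← h]
    simp only [discInner, mul_assoc]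
  rw [hcoef]

/-- Hyperinterpolation commutes with subtraction. -/
theorem hyper_sub {m : ℕ} (w x : Fin m → ℝ) (p : ℕ → Polynomial ℝ) (n : ℕ) (f g : ℝ → ℝ) :
    hyper w x p n (fun y => f y - g y) = hyper w x p n f - hyper w x p n g := by
  simp only [hyper, discInner, ← Finset.sum_sub_distrib, ← sub_mul, ← Polynomial.C_sub, mul_sub]

/-- `‖L_n g‖² = ⟨g, L_n g⟩_m`. -/
theorem integral_hyper_sq {m : ℕ} (w x : Fin m → ℝ) (p : ℕ → Polynomial ℝ) (n : ℕ)
    (horth : ∀ ℓ ℓ', ℓ ≤ n → ℓ' ≤ n →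
      (∫ y in (-1 : ℝ)..1, (p ℓ).eval y * (p ℓ').eval y) = if ℓ = ℓ' then 1 else 0)
    (g : ℝ → ℝ) :
    (∫ y in (-1 : ℝ)..1, ((hyper w x p n g).eval y) ^ 2) =
      discInner w x g (fun y => (hyper w x p n g).eval y) := by
  set a : ℕ → ℝ := fun ℓ => discInner w x g (fun y => (p ℓ).eval y) with ha
  have hH : hyper w x p n g = ∑ ℓ ∈ Finset.range (n + 1), Polynomial.C (a ℓ) * p ℓ := rfl
  have hleft : (∫ y in (-1 : ℝ)..1, ((hyper w x p n g).eval y) ^ 2) =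
      ∑ ℓ ∈ Finset.range (n + 1), a ℓ * a ℓ := by
    have hpt : ∀ y : ℝ, ((hyper w x p n g).eval y) ^ 2 =
        ∑ ℓ ∈ Finset.range (n + 1), a ℓ * ((hyper w x p n g).eval y * (p ℓ).eval y) := by
      intro y
      rw [sq]
      nth_rewrite 2 [hH]
      rw [Polynomial.eval_finsetSum, Finset.mul_sum]
      refine Finset.sum_congr rfl fun ℓ _ => ?_
      rw [Polynomial.eval_mul, Polynomial.eval_C]
      ring
    simp only [hpt]
    rw [intervalIntegral.integral_finsetSum
      fun ℓ _ => Continuous.intervalIntegrable (by fun_prop) _ _]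
    refine Finset.sum_congr rfl fun ℓ hℓ => ?_
    rw [intervalIntegral.integral_const_mul, hH, integral_sum_mul_of_orthonormal p n horth a ℓ
      (by have := Finset.mem_range.1 hℓ; lia)]
  rw [hleft, hH]
  simp only [discInner, Polynomial.eval_finsetSum, Polynomial.eval_mul, Polynomial.eval_C,
    Finset.mul_sum]
  rw [Finset.sum_comm]
  refine Finset.sum_congr rfl fun ℓ _ => ?_
  nth_rewrite 2 [ha]
  simp only [discInner, Finset.mul_sum]
  exact Finset.sum_congr rfl fun j _ => by ring

/-- Stability of hyperinterpolation under the upper Marcinkiewicz–Zygmund inequality with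
constant `3/4`. -/
theorem integral_hyper_sq_le {m : ℕ} (w x : Fin m → ℝ) (p : ℕ → Polynomial ℝ) (n : ℕ)
    (hx : ∀ j, x j ∈ Set.Icc (-1 : ℝ) 1) (hw : ∀ j, 0 < w j) (hsum : ∑ j, w j = 2)
    (hMZ : ∀ χ : Polynomial ℝ, χ.natDegree ≤ n →
      |(∑ j, w j * (χ.eval (x j)) ^ 2) - ∫ y in (-1 : ℝ)..1, (χ.eval y) ^ 2| ≤
        (3 / 4 : ℝ) * ∫ y in (-1 : ℝ)..1, (χ.eval y) ^ 2)
    (hdeg : ∀ ℓ, ℓ ≤ n → (p ℓ).natDegree = ℓ)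
    (horth : ∀ ℓ ℓ', ℓ ≤ n → ℓ' ≤ n →
      (∫ y in (-1 : ℝ)..1, (p ℓ).eval y * (p ℓ').eval y) = if ℓ = ℓ' then 1 else 0)
    (g : ℝ → ℝ) (e : ℝ) (hg : ∀ y ∈ Set.Icc (-1 : ℝ) 1, |g y| ≤ e) :
    (∫ y in (-1 : ℝ)..1, ((hyper w x p n g).eval y) ^ 2) ≤ 7 / 2 * e ^ 2 := by
  have hN := integral_hyper_sq w x p n horth g
  have hd : (hyper w x p n g).natDegree ≤ n := by
    refine Polynomial.natDegree_sum_le_of_forall_le _ _ fun ℓ hℓ => ?_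
    have hℓ' : ℓ ≤ n := by have := Finset.mem_range.1 hℓ; lia
    exact (Polynomial.natDegree_C_mul_le _ _).trans (by rw [hdeg ℓ hℓ']; exact hℓ')
  have hmz := (abs_le.1 (hMZ _ hd)).2
  set H := hyper w x p n g
  have hle : discInner w x g (fun y => H.eval y) ≤
      ∑ j, (w j * (7 / 8 * e ^ 2) + 2 / 7 * (w j * (H.eval (x j)) ^ 2)) := by
    refine Finset.sum_le_sum fun j _ => ?_
    have hsq : (g (x j)) ^ 2 ≤ e ^ 2 := sq_le_sq' (abs_le.1 (hg _ (hx j))).1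
      (abs_le.1 (hg _ (hx j))).2
    have hyoung : g (x j) * H.eval (x j) ≤ 7 / 8 * e ^ 2 + 2 / 7 * (H.eval (x j)) ^ 2 := by
      nlinarith [sq_nonneg (7 * g (x j) - 4 * H.eval (x j))]
    calc w j * g (x j) * H.eval (x j) = w j * (g (x j) * H.eval (x j)) := by ring
      _ ≤ w j * (7 / 8 * e ^ 2 + 2 / 7 * (H.eval (x j)) ^ 2) :=
        mul_le_mul_of_nonneg_left hyoung (hw j).le
      _ = _ := by ring
  rw [Finset.sum_add_distrib, ← Finset.sum_mul, ← Finset.mul_sum, hsum] at hle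
  linarith

/-- Clenshaw–Curtis-type instance: an `m`-point positive-weight rule of
exactness degree `m−1` with `n+2 ≤ m ≤ 2n+1` and Marcinkiewicz–Zygmund constant
`η = 3/4` yields `‖L_n f − f‖₂ ≤ 3·√2·E_{m−1−n}(f)`. -/
theorem hyper_clenshaw_curtis_instance
    (n m : ℕ) (hn : 1 ≤ n) (hm1 : n + 2 ≤ m) (hm2 : m ≤ 2 * n + 1)
    (x w : Fin m → ℝ)
    (hx : ∀ j, x j ∈ Set.Icc (-1 : ℝ) 1)
    (hw : ∀ j, 0 < w j)
    (hex : ∀ g : Polynomial ℝ, g.natDegree ≤ m - 1 →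
      ∑ j, w j * g.eval (x j) = ∫ y in (-1 : ℝ)..1, g.eval y)
    (hMZ : ∀ χ : Polynomial ℝ, χ.natDegree ≤ n →
      |(∑ j, w j * (χ.eval (x j)) ^ 2) - ∫ y in (-1 : ℝ)..1, (χ.eval y) ^ 2| ≤
        (3 / 4 : ℝ) * ∫ y in (-1 : ℝ)..1, (χ.eval y) ^ 2)
    (p : ℕ → Polynomial ℝ)
    (hdeg : ∀ ℓ, ℓ ≤ n → (p ℓ).natDegree = ℓ)
    (horth : ∀ ℓ ℓ', ℓ ≤ n → ℓ' ≤ n →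
      (∫ y in (-1 : ℝ)..1, (p ℓ).eval y * (p ℓ').eval y) = if ℓ = ℓ' then 1 else 0)
    (f : ℝ → ℝ) (hf : ContinuousOn f (Set.Icc (-1 : ℝ) 1)) :
    Real.sqrt (∫ y in (-1 : ℝ)..1, ((hyper w x p n f).eval y - f y) ^ 2) ≤
      3 * Real.sqrt 2 *
        ⨅ χ : {q : Polynomial ℝ // q.natDegree ≤ m - 1 - n},
          ⨆ t : Set.Icc (-1 : ℝ) 1, |f t - (χ : Polynomial ℝ).eval (t : ℝ)| := by
  have hsum : ∑ j, w j = 2 := by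
    have h := hex 1 (by simp)
    simp only [Polynomial.eval_one, mul_one, intervalIntegral.integral_const, smul_eq_mul] at h
    rw [h]
    norm_num
  rw [Real.mul_iInf_of_nonneg (by positivity)]
  have : Nonempty {q : Polynomial ℝ // q.natDegree ≤ m - 1 - n} := ⟨⟨0, by simp⟩⟩
  refine le_ciInf fun ⟨χ, hχ⟩ => ?_
  set g : ℝ → ℝ := fun y => f y - χ.eval y with hgdef
  have hgc : ContinuousOn g (Set.Icc (-1 : ℝ) 1) := hf.sub χ.continuous.continuousOn
  have hbdd : BddAbove (Set.range fun t : Set.Icc (-1 : ℝ) 1 => |g t|) := by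
    have h := (isCompact_Icc.image_of_continuousOn hgc.abs).bddAbove
    rwa [Set.image_eq_range] at h
  change _ ≤ 3 * Real.sqrt 2 * ⨆ t : Set.Icc (-1 : ℝ) 1, |g t|
  set e : ℝ := ⨆ t : Set.Icc (-1 : ℝ) 1, |g t|
  have hg : ∀ y ∈ Set.Icc (-1 : ℝ) 1, |g y| ≤ e := fun y hy => le_ciSup hbdd ⟨y, hy⟩
  have he : 0 ≤ e := Real.iSup_nonneg fun _ => abs_nonneg _
  have hstab := integral_hyper_sq_le w x p n hx hw hsum hMZ hdeg horth g e hg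
  have hrep := hyper_polynomial_eq w x p n (m - 1) hex hdeg horth χ (by lia) (by lia)
  have hsub := hyper_sub w x p n f (fun y => χ.eval y)
  rw [hrep] at hsub
  have herr : ∀ y, (hyper w x p n f).eval y - f y = (hyper w x p n g).eval y - g y := by
    intro y
    rw [hgdef, hsub, Polynomial.eval_sub]
    ring
  simp only [herr]
  set H := hyper w x p n g
  have hHc : ContinuousOn (fun y => H.eval y) (Set.Icc (-1 : ℝ) 1) := H.continuous.continuousOn
  have hint : (∫ y in (-1 : ℝ)..1, (H.eval y - g y) ^ 2) ≤
      ∫ y in (-1 : ℝ)..1, (2 * (H.eval y) ^ 2 + 2 * e ^ 2) := by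
    refine intervalIntegral.integral_mono_on (by norm_num) ?_ ?_ fun y hy => ?_
    · exact ((hHc.sub hgc).pow 2).intervalIntegrable_of_Icc (by norm_num)
    · exact Continuous.intervalIntegrable (by fun_prop) _ _
    · have hsq : (g y) ^ 2 ≤ e ^ 2 := sq_le_sq' (abs_le.1 (hg y hy)).1 (abs_le.1 (hg y hy)).2
      nlinarith [sq_nonneg (H.eval y + g y)]
  rw [intervalIntegral.integral_add (Continuous.intervalIntegrable (by fun_prop) _ _)
    (Continuous.intervalIntegrable (by fun_prop) _ _), intervalIntegral.integral_const_mul,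
    intervalIntegral.integral_const, smul_eq_mul] at hint
  refine Real.sqrt_le_iff.2 ⟨by positivity, ?_⟩
  rw [mul_pow, mul_pow, Real.sq_sqrt zero_le_two]
  nlinarith [sq_nonneg e]
end
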